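/- arXiv:1805.05071 — 2 statements merged into one kernel-verified Lean document; each statement's English description precedes it below -/
import Mathlib

section
/- Let ν be a probability distribution on [0,1] and let μ ∈ (0,1). Then for all ε ∈ [0, μ − E(ν)] (assuming E(ν) ≤ μ), one has K_inf(ν, μ) ≥ K_inf(ν, μ − ε) + 2 ε². -/
open MeasureTheory Real ENNReal
open scoped Classical

/-- Kullback–Leibler divergence between two measures on `ℝ`, equal to
`∫ ln(dν/dν') dν` when `ν ≪ ν'` (and this integral is well defined), and `+∞` otherwise. -/
noncomputable def KL (ν ν' : Measure ℝ) : ℝ≥0∞ :=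
  if ν ≪ ν' ∧ Integrable (fun x => Real.log ((ν.rnDeriv ν' x).toReal)) ν
  then ENNReal.ofReal (∫ x, Real.log ((ν.rnDeriv ν' x).toReal) ∂ν)
  else ⊤

/-- `K_inf(ν, x)`: infimum of `KL(ν, ν')` over probability measures `ν'` on `[0,1]`
with mean `> x`. The infimum of the empty set is `+∞`. -/
noncomputable def Kinf (ν : Measure ℝ) (x : ℝ) : ℝ≥0∞ :=
  ⨅ (ν' : Measure ℝ) (_ : IsProbabilityMeasure ν')
    (_ : ν' (Set.Icc (0:ℝ) 1)ᶜ = 0) (_ : x < ∫ y, y ∂ν'), KL ν ν'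

lemma aux_int {ν : Measure ℝ} [IsProbabilityMeasure ν]
    (hs : ν (Set.Icc (0:ℝ) 1)ᶜ = 0) : Integrable (fun x : ℝ => x) ν :=
  Integrable.of_mem_Icc 0 1 aemeasurable_id (by rw [ae_iff]; exact hs)

lemma aux_pinsker {ν ν' : Measure ℝ} [IsProbabilityMeasure ν] [IsProbabilityMeasure ν']
    (hs : ν (Set.Icc (0:ℝ) 1)ᶜ = 0) (hs' : ν' (Set.Icc (0:ℝ) 1)ᶜ = 0)
    (hac : ν ≪ ν') (hi : Integrable (llr ν ν') ν) :
    2 * ((∫ y, y ∂ν') - ∫ y, y ∂ν) ^ 2 ≤ ∫ x, llr ν ν' x ∂ν := by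
  have hsub := ProbabilityTheory.hasSubgaussianMGF_of_mem_Icc (μ := ν') (X := fun x : ℝ => x)
    (a := 0) (b := 1) aemeasurable_id (by rw [ae_iff]; exact hs')
  set m' := ∫ y, y ∂ν' with hm'
  set m := ∫ y, y ∂ν with hm
  set t : ℝ := 4 * (m - m') with ht
  have hcgf := hsub.cgf_le t
  have hexp := hsub.integrable_exp_mul t
  have h1 := aux_int hs
  have hfν : Integrable (fun x : ℝ => t * (x - m')) ν :=
    (h1.sub (integrable_const m')).const_mul t
  have hint := integral_llr_tilted_right hac hfν hexp hi
  have := isProbabilityMeasure_tilted hexp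
  have hac2 := hac.trans (absolutelyContinuous_tilted hexp)
  have hnn := InformationTheory.toReal_klDiv_of_measure_eq hac2 (by simp)
  have hnn2 : 0 ≤ ∫ x, llr ν (ν'.tilted fun x => t * (x - m')) x ∂ν := by
    rw [← hnn]; exact ENNReal.toReal_nonneg
  rw [hint] at hnn2
  have hf : ∫ x, t * (x - m') ∂ν = t * (m - m') := by
    rw [integral_const_mul, integral_sub h1 (integrable_const m')]; simp [hm]
  rw [hf] at hnn2
  have hc : log (∫ x, rexp (t * (x - m')) ∂ν') ≤ t ^ 2 / 8 := by
    refine hcgf.trans (le_of_eq ?_)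
    norm_num
    ring
  nlinarith

lemma aux_mix {ν ν' : Measure ℝ} [IsProbabilityMeasure ν] [IsProbabilityMeasure ν']
    (hac : ν ≪ ν') (hi : Integrable (llr ν ν') ν) (a : ℝ) (ha0 : 0 ≤ a) (ha1 : a < 1)
    (ρ : Measure ℝ) [IsProbabilityMeasure ρ]
    (hρ : ρ = ENNReal.ofReal (1 - a) • ν' + ENNReal.ofReal a • ν) :
    ν ≪ ρ ∧ Integrable (llr ν ρ) ν ∧ ∫ x, llr ν ρ x ∂ν ≤ (1 - a) * ∫ x, llr ν ν' x ∂ν := by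
  have hne : ENNReal.ofReal (1 - a) ≠ 0 := by simp; linarith
  have hacρ : ν ≪ ρ := by
    rw [hρ]
    exact (hac.trans (Measure.absolutelyContinuous_smul hne)).add_right _
  have f1 : IsFiniteMeasure (ENNReal.ofReal (1 - a) • ν') := Measure.smul_finite _ (by simp)
  have f2 : IsFiniteMeasure (ENNReal.ofReal a • ν) := Measure.smul_finite _ (by simp)
  have key : ∀ᵐ x ∂ν, rexp (- llr ν ρ x) = (1 - a) * (ν'.rnDeriv ν x).toReal + a ∧
      rexp (- llr ν ν' x) = (ν'.rnDeriv ν x).toReal := by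
    have e := Measure.rnDeriv_add (ENNReal.ofReal (1 - a) • ν') (ENNReal.ofReal a • ν) ν
    rw [← hρ] at e
    filter_upwards [exp_neg_llr hacρ, exp_neg_llr hac, e,
      Measure.rnDeriv_smul_left_of_ne_top ν' ν (r := ENNReal.ofReal (1 - a)) (by simp),
      Measure.rnDeriv_smul_left_of_ne_top ν ν (r := ENNReal.ofReal a) (by simp),
      Measure.rnDeriv_self ν, Measure.rnDeriv_lt_top ν' ν] with x h1 h2 h3 h4 h5 h6 h7
    refine ⟨?_, h2⟩
    rw [h1, h3, Pi.add_apply, h4, h5, Pi.smul_apply, Pi.smul_apply, h6, smul_eq_mul, smul_eq_mul,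
      mul_one, ENNReal.toReal_add (ENNReal.mul_ne_top (by simp) h7.ne) (by simp),
      ENNReal.toReal_mul, ENNReal.toReal_ofReal (by linarith), ENNReal.toReal_ofReal ha0]
  have hup : ∀ᵐ x ∂ν, llr ν ρ x ≤ (1 - a) * llr ν ν' x := by
    filter_upwards [key] with x ⟨h1, h2⟩
    rw [← h2] at h1
    have := convexOn_exp.2 (Set.mem_univ (- llr ν ν' x)) (Set.mem_univ 0)
      (by linarith : 0 ≤ 1 - a) ha0 (by ring)
    simp only [smul_eq_mul, mul_zero, add_zero, Real.exp_zero, mul_one] at this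
    rw [← h1, Real.exp_le_exp] at this
    linarith
  have hlo : ∀ᵐ x ∂ν, 1 - ((1 - a) * (ν'.rnDeriv ν x).toReal + a) ≤ llr ν ρ x := by
    filter_upwards [key] with x ⟨h1, h2⟩
    rw [← h1]
    linarith [Real.add_one_le_exp (- llr ν ρ x)]
  have hint : Integrable (llr ν ρ) ν :=
    integrable_of_le_of_le (measurable_llr ν ρ).aestronglyMeasurable hlo hup
      ((integrable_const 1).sub
        ((Measure.integrable_toReal_rnDeriv.const_mul _).add (integrable_const a)))
      (hi.const_mul _)
  refine ⟨hacρ, hint, ?_⟩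
  rw [← integral_const_mul]
  exact integral_mono_ae hint (hi.const_mul _) hup

/-- For a probability distribution `ν` on `[0,1]`, `μ ∈ (0,1)` with `E(ν) ≤ μ`, and
`ε ∈ [0, μ − E(ν)]`: `K_inf(ν, μ) ≥ K_inf(ν, μ − ε) + 2 ε²`. -/
theorem kinf_lower_regularity (ν : Measure ℝ) [IsProbabilityMeasure ν]
    (hsupp : ν (Set.Icc (0:ℝ) 1)ᶜ = 0)
    (μ : ℝ) (hμ : μ ∈ Set.Ioo (0:ℝ) 1)
    (hEν : (∫ y, y ∂ν) ≤ μ)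
    (ε : ℝ) (hε : ε ∈ Set.Icc 0 (μ - ∫ y, y ∂ν)) :
    Kinf ν (μ - ε) + ENNReal.ofReal (2 * ε ^ 2) ≤ Kinf ν μ := by
  conv_rhs => unfold Kinf
  refine le_iInf fun ν' => le_iInf fun hp => le_iInf fun hs' => le_iInf fun hm' => ?_
  by_cases hc : ν ≪ ν' ∧ Integrable (fun x => Real.log ((ν.rnDeriv ν' x).toReal)) ν
  swap
  · simp [KL, hc]
  obtain ⟨hac, hi⟩ := hc
  have hpin := aux_pinsker hsupp hs' hac hi
  have h1 := aux_int hsupp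
  have h1' := aux_int hs'
  obtain ⟨he0, he1⟩ := hε
  set m' := ∫ y, y ∂ν' with hm'd
  set m := ∫ y, y ∂ν with hmd
  have hd : 0 < m' - m := by linarith
  set a : ℝ := ε / (m' - m) with ha
  have ha0 : 0 ≤ a := by positivity
  have ha1 : a < 1 := by rw [ha, div_lt_one hd]; linarith
  have had : a * (m' - m) = ε := by rw [ha]; field_simp
  set ρ : Measure ℝ := ENNReal.ofReal (1 - a) • ν' + ENNReal.ofReal a • ν with hρ
  have hpρ : IsProbabilityMeasure ρ := by
    constructor
    rw [hρ]
    simp only [Measure.add_apply, Measure.smul_apply, measure_univ, smul_eq_mul, mul_one]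
    rw [← ENNReal.ofReal_add (by linarith) ha0]
    simp
  have hsρ : ρ (Set.Icc (0:ℝ) 1)ᶜ = 0 := by
    rw [hρ]; simp only [Measure.add_apply, Measure.smul_apply, hs', hsupp]; simp
  have hmρ : ∫ y, y ∂ρ = (1 - a) * m' + a * m := by
    rw [hρ, integral_add_measure (h1'.smul_measure (by simp)) (h1.smul_measure (by simp)),
      integral_smul_measure, integral_smul_measure, ENNReal.toReal_ofReal (by linarith),
      ENNReal.toReal_ofReal ha0]
    rfl
  have hmean : μ - ε < ∫ y, y ∂ρ := by rw [hmρ]; nlinarith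
  obtain ⟨hacρ, hiρ, hle⟩ := aux_mix hac hi a ha0 ha1 ρ hρ
  have hK : Kinf ν (μ - ε) ≤ KL ν ρ :=
    iInf_le_of_le ρ (iInf_le_of_le hpρ (iInf_le_of_le hsρ (iInf_le_of_le hmean le_rfl)))
  have hnn : 0 ≤ ∫ x, llr ν ρ x ∂ν := by
    rw [← InformationTheory.toReal_klDiv_of_measure_eq hacρ (by simp)]
    exact ENNReal.toReal_nonneg
  have hKρ : KL ν ρ = ENNReal.ofReal (∫ x, llr ν ρ x ∂ν) := if_pos ⟨hacρ, hiρ⟩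
  have hKν : KL ν ν' = ENNReal.ofReal (∫ x, llr ν ν' x ∂ν) := if_pos ⟨hac, hi⟩
  refine (add_le_add_left hK _).trans ?_
  rw [hKρ, hKν, ← ENNReal.ofReal_add hnn (by positivity)]
  apply ENNReal.ofReal_le_ofReal
  have e1 : a * (2 * (m' - m) ^ 2) ≤ a * ∫ x, llr ν ν' x ∂ν :=
    mul_le_mul_of_nonneg_left hpin ha0
  have e2 : a * (2 * (m' - m) ^ 2) = 2 * ε * (m' - m) := by rw [← had]; ring
  have e3 : ε * ε ≤ ε * (m' - m) := mul_le_mul_of_nonneg_left (by linarith) he0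
  nlinarith
end

section
/- Let ν be a probability distribution on [0,1], let μ ∈ (0,1), let u > 0 and let ε > 0. If K_inf(ν, μ − ε) > u, then K_inf(ν, μ) > u + 2 ε². -/
open MeasureTheory Real ENNReal
open scoped Classical

theorem pinsker_core (q : Measure ℝ) [IsProbabilityMeasure q]
    (hq : q (Set.Icc (0:ℝ) 1)ᶜ = 0) (P : ℝ → ℝ) (hP0 : ∀ x, 0 ≤ P x)
    (hPi : Integrable P q) (hP1 : ∫ x, P x ∂q = 1) (t : ℝ) (ht0 : 0 < t) (ht1 : t < 1)
    (hL : Integrable (fun x => P x * Real.log (1 - t + t * P x)) q) :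
    2 * (t * (∫ x, P x * x ∂q - ∫ x, x ∂q)) ^ 2 ≤ ∫ x, P x * Real.log (1 - t + t * P x) ∂q := by
  have hae : ∀ᵐ x ∂q, x ∈ Set.Icc (0:ℝ) 1 := by
    rw [ae_iff]; exact hq
  set M := ∫ x, x ∂q with hM
  set m := ∫ x, P x * x ∂q with hm
  set d := t * (m - M) with hd
  have hsub := ProbabilityTheory.hasSubgaussianMGF_of_mem_Icc (μ := q) (X := fun x => x)
    (a := 0) (b := 1) aemeasurable_id hae
  have hexpi := hsub.integrable_exp_mul (4 * d)
  have hmgf := hsub.mgf_le (4 * d)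
  simp only [ProbabilityTheory.mgf] at hmgf
  rw [← hM] at hmgf hexpi
  have hxi : Integrable (fun x : ℝ => x) q := Integrable.of_mem_Icc 0 1 aemeasurable_id hae
  have hPx : Integrable (fun x => P x * x) q := by
    refine hPi.mono (hPi.aestronglyMeasurable.mul aestronglyMeasurable_id) ?_
    filter_upwards [hae] with x hx
    rw [norm_mul]
    have : ‖x‖ ≤ 1 := by rw [Real.norm_eq_abs, abs_le]; constructor <;> linarith [hx.1, hx.2]
    exact mul_le_of_le_one_right (norm_nonneg _) this
  have key : ∀ x, (1 - t) * (4 * d) * x + t * (4 * d) * (P x * x)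
      - (4 * d * M + 2 * d ^ 2 - 1) * (1 - t) - (4 * d * M + 2 * d ^ 2 - 1) * t * P x
      - Real.exp (- (2 * d ^ 2)) * Real.exp (4 * d * (x - M))
      ≤ P x * Real.log (1 - t + t * P x) := by
    intro x
    rw [← Real.exp_add]
    set g := 1 - t + t * P x with hg
    have hgpos : 0 < g := by have := mul_nonneg ht0.le (hP0 x); linarith
    set s := -(2 * d ^ 2) + 4 * d * (x - M) with hs
    have h1 : g * s + g - Real.exp s ≤ g * Real.log g := by
      have := Real.add_one_le_exp (s - Real.log g)
      rw [Real.exp_sub, Real.exp_log hgpos, le_div_iff₀ hgpos] at this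
      nlinarith
    have h2 : g * Real.log g ≤ P x * Real.log g := by
      have hdiff : P x - g = (1 - t) * (P x - 1) := by rw [hg]; ring
      have : 0 ≤ (P x - g) * Real.log g := by
        rw [hdiff]
        rcases le_total 1 (P x) with h | h
        · have : 0 ≤ Real.log g := Real.log_nonneg (by rw [hg]; nlinarith)
          exact mul_nonneg (mul_nonneg (by linarith) (by linarith)) this
        · have : Real.log g ≤ 0 := Real.log_nonpos hgpos.le (by rw [hg]; nlinarith)
          exact mul_nonneg_of_nonpos_of_nonpos
            (mul_nonpos_of_nonneg_of_nonpos (by linarith) (by linarith)) this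
      nlinarith
    refine le_trans (le_of_eq ?_) (h1.trans h2)
    rw [hg, hs]; ring
  have i1 := hxi.const_mul ((1 - t) * (4 * d))
  have i2 := hPx.const_mul (t * (4 * d))
  have i3 : Integrable (fun _ : ℝ => (4 * d * M + 2 * d ^ 2 - 1) * (1 - t)) q :=
    integrable_const _
  have i4 := hPi.const_mul ((4 * d * M + 2 * d ^ 2 - 1) * t)
  have i5 := hexpi.const_mul (Real.exp (- (2 * d ^ 2)))
  have hint := integral_mono ((((i1.add i2).sub i3).sub i4).sub i5) hL key
  refine le_trans ?_ hint
  have e := integral_sub (((i1.add i2).sub i3).sub i4) i5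
  have e2 := integral_sub ((i1.add i2).sub i3) i4
  have e3 := integral_sub (i1.add i2) i3
  have e4 := integral_add i1 i2
  simp only [Pi.add_apply, Pi.sub_apply] at e e2 e3 e4 ⊢
  have e1 : ∫ x, (1 - t) * (4 * d) * x ∂q = (1 - t) * (4 * d) * M := integral_const_mul _ _
  rw [e, e2, e3, e4, e1]
  simp only [integral_const_mul, integral_const, probReal_univ, one_smul, hP1, ← hm]
  have hE : Real.exp (- (2 * d ^ 2)) * ∫ x, Real.exp (4 * d * (x - M)) ∂q ≤ 1 := by
    calc _ ≤ Real.exp (- (2 * d ^ 2)) * Real.exp (2 * d ^ 2) := by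
          gcongr
          refine hmgf.trans (le_of_eq ?_)
          congr 1
          simp
          ring
      _ = 1 := by rw [← Real.exp_add]; simp
  have : t * (4 * d) * m = 4 * d * (d + t * M) := by rw [hd]; ring
  rw [this]
  linarith

theorem KL_self_zero (ν : Measure ℝ) [IsProbabilityMeasure ν] : KL ν ν = 0 := by
  have h : (fun x => Real.log ((ν.rnDeriv ν x).toReal)) =ᵐ[ν] fun _ => 0 := by
    filter_upwards [Measure.rnDeriv_self ν] with x hx
    simp [hx]
  unfold KL
  split_ifs with hh
  · rw [integral_congr_ae h]; simp
  · exact absurd ⟨Measure.AbsolutelyContinuous.rfl, (integrable_congr h).2 (integrable_const _)⟩ hh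

theorem KL_mix (ν q : Measure ℝ) [IsProbabilityMeasure ν] [IsProbabilityMeasure q]
    (hν : ν (Set.Icc (0:ℝ) 1)ᶜ = 0)
    (hq : q (Set.Icc (0:ℝ) 1)ᶜ = 0) (t : ℝ) (ht0 : 0 < t) (ht1 : t < 1)
    [IsProbabilityMeasure (ENNReal.ofReal (1 - t) • q + ENNReal.ofReal t • ν)] :
    KL ν (ENNReal.ofReal (1 - t) • q + ENNReal.ofReal t • ν)
      + ENNReal.ofReal (2 * (t * (∫ x, x ∂ν - ∫ x, x ∂q)) ^ 2) ≤ KL ν q := by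
  by_cases hh : ν ≪ q ∧ Integrable (fun x => Real.log ((ν.rnDeriv q x).toReal)) ν
  swap
  · have : KL ν q = ⊤ := by unfold KL; rw [if_neg hh]
    rw [this]; exact le_top
  obtain ⟨hac, hint⟩ := hh
  set r := ENNReal.ofReal (1 - t) • q + ENNReal.ofReal t • ν with hr
  set P : ℝ → ℝ := fun x => (ν.rnDeriv q x).toReal with hP
  have hPm : Measurable P := (Measure.measurable_rnDeriv ν q).ennreal_toReal
  have hP0 : ∀ x, 0 ≤ P x := fun x => ENNReal.toReal_nonneg
  have hνP : ν = q.withDensity (fun x => ENNReal.ofReal (P x)) := by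
    conv_lhs => rw [← Measure.withDensity_rnDeriv_eq ν q hac]
    apply withDensity_congr_ae
    filter_upwards [Measure.rnDeriv_lt_top ν q] with x hx
    exact (ENNReal.ofReal_toReal hx.ne).symm
  set g : ℝ → ℝ := fun x => 1 - t + t * P x with hg
  have hgm : Measurable g := by fun_prop
  have hgpos : ∀ x, 0 < g x := fun x => by
    have := mul_nonneg ht0.le (hP0 x); simp only [hg]; linarith
  have hrg : r = q.withDensity (fun x => ENNReal.ofReal (g x)) := by
    have : (fun x => ENNReal.ofReal (g x)) =
        (fun _ => ENNReal.ofReal (1 - t)) + ENNReal.ofReal t • fun x => ENNReal.ofReal (P x) := by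
      funext x
      simp only [hg, Pi.add_apply, Pi.smul_apply, smul_eq_mul]
      rw [ENNReal.ofReal_add (by linarith) (mul_nonneg ht0.le (hP0 x)), ENNReal.ofReal_mul ht0.le]
    rw [this, withDensity_add_left measurable_const, withDensity_const,
      withDensity_smul _ hPm.ennreal_ofReal, ← hνP]
  have hdm : Measurable (fun x => ENNReal.ofReal (P x / g x)) := (hPm.div hgm).ennreal_ofReal
  have hνr : ν = r.withDensity (fun x => ENNReal.ofReal (P x / g x)) := by
    rw [hrg, ← withDensity_mul _ hgm.ennreal_ofReal hdm]
    conv_lhs => rw [hνP]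
    congr 1
    funext x
    simp only [Pi.mul_apply]
    rw [← ENNReal.ofReal_mul (hgpos x).le, mul_div_cancel₀ _ (hgpos x).ne']
  have hacr : ν ≪ r := by
    rw [hνr]; exact withDensity_absolutelyContinuous _ _
  have hrn : ν.rnDeriv r =ᵐ[ν] fun x => ENNReal.ofReal (P x / g x) := by
    apply hacr.ae_le
    have := Measure.rnDeriv_withDensity r hdm
    rw [← hνr] at this
    exact this
  have hpos : ∀ᵐ x ∂ν, 0 < P x := by
    filter_upwards [Measure.rnDeriv_pos hac, hac.ae_le (Measure.rnDeriv_lt_top ν q)] with x h1 h2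
    exact ENNReal.toReal_pos h1.ne' h2.ne
  have hlog : (fun x => Real.log ((ν.rnDeriv r x).toReal)) =ᵐ[ν]
      fun x => Real.log (P x) - Real.log (g x) := by
    filter_upwards [hrn, hpos] with x h1 h2
    rw [h1, ENNReal.toReal_ofReal (div_nonneg (hP0 x) (hgpos x).le),
      Real.log_div h2.ne' (hgpos x).ne']
  have hgi : Integrable (fun x => Real.log (g x)) ν := by
    refine (hint.norm.add (integrable_const |Real.log (1 - t)|)).mono'
      (hgm.log.aestronglyMeasurable) ?_
    filter_upwards [hpos] with x hx
    simp only [Pi.add_apply, Real.norm_eq_abs]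
    have h1 : Real.log (1 - t) ≤ Real.log (g x) := by
      apply Real.log_le_log (by linarith)
      have := mul_nonneg ht0.le (hP0 x); simp only [hg]; linarith
    have h2 : Real.log (g x) ≤ |Real.log (P x)| := by
      rcases le_total 1 (P x) with h | h
      · refine le_trans (Real.log_le_log (hgpos x) ?_) (le_abs_self _)
        simp only [hg]; nlinarith
      · refine le_trans (Real.log_nonpos (hgpos x).le ?_) (abs_nonneg _)
        simp only [hg]; nlinarith
    have h3 := neg_abs_le (Real.log (1 - t))
    have h4 := abs_nonneg (Real.log (1 - t))
    have h5 := abs_nonneg (Real.log (P x))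
    change |Real.log (g x)| ≤ |Real.log (P x)| + _
    rw [abs_le]; constructor <;> linarith
  have hri : Integrable (fun x => Real.log ((ν.rnDeriv r x).toReal)) ν :=
    (integrable_congr hlog).2 (hint.sub hgi)
  have hnn : 0 ≤ ∫ x, Real.log ((ν.rnDeriv r x).toReal) ∂ν := by
    have := InformationTheory.integral_llr_add_sub_measure_univ_nonneg hacr hri
    simpa [llr] using this
  -- transfer to q
  have hae : ∀ f : ℝ → ℝ, ∫ x, f x ∂ν = ∫ x, P x * f x ∂q := by
    intro f
    conv_lhs => rw [hνP]
    rw [integral_withDensity_eq_integral_toReal_smul hPm.ennreal_ofReal (by simp)]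
    simp only [ENNReal.toReal_ofReal (hP0 _), smul_eq_mul]
  have hL : Integrable (fun x => P x * Real.log (g x)) q := by
    rw [hνP, integrable_withDensity_iff_integrable_smul' hPm.ennreal_ofReal (by simp)] at hgi
    simpa only [ENNReal.toReal_ofReal (hP0 _), smul_eq_mul] using hgi
  have hcore := pinsker_core q hq P hP0 Measure.integrable_toReal_rnDeriv
    (by have := hae (fun _ => 1); simpa using this.symm) t ht0 ht1 hL
  rw [← hae (fun x => x), ← hae (fun x => Real.log (1 - t + t * P x))] at hcore
  unfold KL
  rw [if_pos ⟨hacr, hri⟩, if_pos ⟨hac, hint⟩, ← ENNReal.ofReal_add hnn (by positivity)]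
  apply ENNReal.ofReal_le_ofReal
  rw [integral_congr_ae hlog, integral_sub hint hgi]
  linarith

/-- For a probability distribution `ν` on `[0,1]`, `μ ∈ (0,1)`, `u > 0` and `ε > 0`:
if `K_inf(ν, μ − ε) > u` then `K_inf(ν, μ) > u + 2 ε²`. -/
theorem kinf_level_set_inclusion (ν : Measure ℝ) [IsProbabilityMeasure ν]
    (hsupp : ν (Set.Icc (0:ℝ) 1)ᶜ = 0)
    (μ : ℝ) (hμ : μ ∈ Set.Ioo (0:ℝ) 1)
    (u : ℝ) (hu : 0 < u) (ε : ℝ) (hε : 0 < ε)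
    (h : ENNReal.ofReal u < Kinf ν (μ - ε)) :
    ENNReal.ofReal (u + 2 * ε ^ 2) < Kinf ν μ := by
  have hle : ∀ q : Measure ℝ, IsProbabilityMeasure q → q (Set.Icc (0:ℝ) 1)ᶜ = 0 →
      μ - ε < ∫ y, y ∂q → Kinf ν (μ - ε) ≤ KL ν q := fun q h1 h2 h3 =>
    iInf_le_of_le q (iInf_le_of_le h1 (iInf_le_of_le h2 (iInf_le_of_le h3 le_rfl)))
  have hm : ∫ y, y ∂ν ≤ μ - ε := by
    by_contra hcon
    push Not at hcon
    have := hle ν inferInstance hsupp hcon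
    rw [KL_self_zero] at this
    exact absurd (h.trans_le this) (by simp)
  have main : Kinf ν (μ - ε) + ENNReal.ofReal (2 * ε ^ 2) ≤ Kinf ν μ := by
    refine le_iInf fun q => le_iInf fun h1 => le_iInf fun h2 => le_iInf fun h3 => ?_
    set m := ∫ y, y ∂ν with hmdef
    set M := ∫ y, y ∂q with hMdef
    have hD : 0 < M - m := by linarith
    set t := ε / (M - m) with ht
    have ht0 : 0 < t := div_pos hε hD
    have ht1 : t < 1 := by rw [ht, div_lt_one hD]; linarith
    have htD : t * (M - m) = ε := div_mul_cancel₀ _ hD.ne'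
    have hprob : IsProbabilityMeasure (ENNReal.ofReal (1 - t) • q + ENNReal.ofReal t • ν) := by
      constructor
      simp only [Measure.add_apply, Measure.smul_apply, measure_univ, smul_eq_mul, mul_one]
      rw [← ENNReal.ofReal_add (by linarith) ht0.le]
      simp
    have hxi : ∀ p : Measure ℝ, IsProbabilityMeasure p → p (Set.Icc (0:ℝ) 1)ᶜ = 0 →
        Integrable (fun x : ℝ => x) p := fun p _ hp2 =>
      Integrable.of_mem_Icc 0 1 aemeasurable_id (by rw [ae_iff]; exact hp2)
    have hmix := KL_mix ν q hsupp h2 t ht0 ht1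
    have hmean : ∫ y, y ∂(ENNReal.ofReal (1 - t) • q + ENNReal.ofReal t • ν) = M - ε := by
      rw [integral_add_measure ((hxi q h1 h2).smul_measure ENNReal.ofReal_ne_top)
        ((hxi ν inferInstance hsupp).smul_measure ENNReal.ofReal_ne_top),
        integral_smul_measure, integral_smul_measure, ENNReal.toReal_ofReal (by linarith),
        ENNReal.toReal_ofReal ht0.le, ← hMdef, ← hmdef]
      simp only [smul_eq_mul]
      linarith
    have hle' := hle _ hprob (by simp [h2, hsupp]) (by rw [hmean]; linarith)
    have hsq : (t * (m - M)) ^ 2 = ε ^ 2 := by rw [← htD]; ring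
    rw [← hmdef, ← hMdef, hsq] at hmix
    exact (add_le_add_left hle' _).trans hmix
  refine lt_of_lt_of_le ?_ main
  rw [ENNReal.ofReal_add hu.le (by positivity)]
  exact ENNReal.add_lt_add_right ENNReal.ofReal_ne_top h
end
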